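/- arXiv:2409.04222 — 8 statements merged into one kernel-verified Lean document; each statement's English description precedes it below -/
import Mathlib

section
/- Let K_v = {(a1,a2) ∈ ℝ² : a1 ≥ 0, a1·a2 ≤ 0}. Then at the origin: (i) the Fréchet normal cone satisfies N̂_{K_v}(0) = {(α1,α2) ∈ ℝ² : α1 ≤ 0, α2 = 0}; (ii) the limiting (Mordukhovich) normal cone satisfies N_{K_v}(0) = {(α1,α2) ∈ ℝ² : α1·α2 = 0, α2 ≥ 0}; (iii) the Clarke normal cone satisfies N̄_{K_v}(0) = {(α1,α2) ∈ ℝ² : α2 ≥ 0}. -/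
open Filter Topology

noncomputable section

/-- Tangent (Bouligand) cone: w ∈ T_M(x) iff there are x_k ∈ M, x_k → x, τ_k ↓ 0
with (x_k - x)/τ_k → w. -/
def tangentCone (M : Set (ℝ × ℝ)) (x : ℝ × ℝ) : Set (ℝ × ℝ) :=
  {w | ∃ (xs : ℕ → ℝ × ℝ) (τ : ℕ → ℝ),
    (∀ k, xs k ∈ M) ∧ Tendsto xs atTop (𝓝 x) ∧
    (∀ k, 0 < τ k) ∧ Tendsto τ atTop (𝓝 0) ∧
    Tendsto (fun k => (τ k)⁻¹ • (xs k - x)) atTop (𝓝 w)}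

/-- Fréchet normal cone: v with ⟨v, w⟩ ≤ 0 for all tangent directions w. -/
def frechetNormalCone (M : Set (ℝ × ℝ)) (x : ℝ × ℝ) : Set (ℝ × ℝ) :=
  {v | ∀ w ∈ tangentCone M x, v.1 * w.1 + v.2 * w.2 ≤ 0}

/-- Mordukhovich (limiting) normal cone. -/
def limitingNormalCone (M : Set (ℝ × ℝ)) (x : ℝ × ℝ) : Set (ℝ × ℝ) :=
  {v | ∃ (xs vs : ℕ → ℝ × ℝ),
    (∀ k, xs k ∈ M) ∧ Tendsto xs atTop (𝓝 x) ∧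
    (∀ k, vs k ∈ frechetNormalCone M (xs k)) ∧ Tendsto vs atTop (𝓝 v)}

/-- Clarke normal cone: closed convex hull of the limiting normal cone. -/
def clarkeNormalCone (M : Set (ℝ × ℝ)) (x : ℝ × ℝ) : Set (ℝ × ℝ) :=
  closure (convexHull ℝ (limitingNormalCone M x))

/-- The vanishing-constraints cone K_v. -/
def Kv : Set (ℝ × ℝ) := {a | 0 ≤ a.1 ∧ a.1 * a.2 ≤ 0}

/-- A feasible direction is tangent. -/
theorem mem_tangentCone_of_forall_add_smul_mem {M : Set (ℝ × ℝ)} {x w : ℝ × ℝ} {δ : ℝ}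
    (hδ : 0 < δ) (h : ∀ t, 0 < t → t ≤ δ → x + t • w ∈ M) : w ∈ tangentCone M x := by
  have hpos : ∀ k : ℕ, 0 < δ / ((k : ℝ) + 1) := fun k => by positivity
  have hlim : Tendsto (fun k : ℕ => δ / ((k : ℝ) + 1)) atTop (𝓝 0) := by
    simpa [div_eq_mul_inv] using (tendsto_one_div_add_atTop_nhds_zero_nat (𝕜 := ℝ)).const_mul δ
  refine ⟨fun k => x + (δ / ((k : ℝ) + 1)) • w, fun k => δ / ((k : ℝ) + 1),
    fun k => h _ (hpos k) (div_le_self hδ.le (by linarith [k.cast_nonneg (α := ℝ)])),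
    by simpa using (hlim.smul_const w).const_add x, hpos, hlim, ?_⟩
  refine tendsto_const_nhds.congr fun k => ?_
  rw [add_sub_cancel_left, inv_smul_smul₀ (hpos k).ne']

/-- If `M - x` is locally contained in a closed set stable under positive scaling, then so is the
tangent cone of `M` at `x`. -/
theorem tangentCone_subset_of_eventually {M C : Set (ℝ × ℝ)} {x : ℝ × ℝ} (hC : IsClosed C)
    (hsmul : ∀ t : ℝ, 0 < t → ∀ y ∈ C, t • y ∈ C) (h : ∀ᶠ y in 𝓝 x, y ∈ M → y - x ∈ C) :
    tangentCone M x ⊆ C := by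
  rintro w ⟨xs, τ, hM, hx, hτ, -, hw⟩
  refine hC.mem_of_tendsto hw ?_
  filter_upwards [hx.eventually h] with k hk
  exact hsmul _ (inv_pos.2 (hτ k)) _ (hk (hM k))

theorem tangentCone_Kv_zero_subset : tangentCone Kv 0 ⊆ {w | 0 ≤ w.1} :=
  tangentCone_subset_of_eventually (isClosed_le continuous_const continuous_fst)
    (fun _ ht _ hy => mul_nonneg ht.le hy) (Eventually.of_forall fun y hy => by simpa using hy.1)

theorem tangentCone_Kv_subset_of_snd_pos {s : ℝ} (hs : 0 < s) :
    tangentCone Kv (0, s) ⊆ {w | w.1 = 0} := by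
  refine tangentCone_subset_of_eventually (isClosed_eq continuous_fst continuous_const)
    (fun t _ y hy => mul_eq_zero_of_right t hy) ?_
  filter_upwards [continuous_snd.continuousAt.eventually (lt_mem_nhds hs)] with y hy hK
  have : y.1 = 0 := le_antisymm (nonpos_of_mul_nonpos_left hK.2 hy) hK.1
  simpa using this

theorem tangentCone_Kv_subset_of_fst_pos {s : ℝ} (hs : 0 < s) :
    tangentCone Kv (s, 0) ⊆ {w | w.2 ≤ 0} := by
  refine tangentCone_subset_of_eventually (isClosed_le continuous_snd continuous_const)
    (fun t ht y hy => mul_nonpos_of_nonneg_of_nonpos ht.le hy) ?_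
  filter_upwards [continuous_fst.continuousAt.eventually (lt_mem_nhds hs)] with y hy hK
  have : y.2 ≤ 0 := nonpos_of_mul_nonpos_right hK.2 hy
  simpa using this

theorem snd_eq_zero_of_mem_frechetNormalCone_Kv {x v : ℝ × ℝ} (hx : x.1 = 0)
    (hv : v ∈ frechetNormalCone Kv x) : v.2 = 0 := by
  have key (c : ℝ) : (0, c) ∈ tangentCone Kv x :=
    mem_tangentCone_of_forall_add_smul_mem one_pos fun t _ _ => by simp [Kv, hx]
  have h₁ := hv _ (key 1)
  have h₂ := hv _ (key (-1))
  simp only at h₁ h₂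
  linarith

theorem frechetNormalCone_Kv_zero :
    frechetNormalCone Kv 0 = {v : ℝ × ℝ | v.1 ≤ 0 ∧ v.2 = 0} := by
  refine Set.Subset.antisymm
    (fun v hv => ⟨?_, snd_eq_zero_of_mem_frechetNormalCone_Kv rfl hv⟩) fun v hv w hw => ?_
  · have h : ((1, 0) : ℝ × ℝ) ∈ tangentCone Kv 0 :=
      mem_tangentCone_of_forall_add_smul_mem one_pos fun t ht _ => by simp [Kv, ht.le]
    simpa using hv _ h
  · have h := mul_nonpos_of_nonpos_of_nonneg hv.1 (tangentCone_Kv_zero_subset hw)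
    simpa [hv.2] using h

theorem frechetNormalCone_Kv_subset {x : ℝ × ℝ} (hx : x ∈ Kv) :
    frechetNormalCone Kv x ⊆ {v : ℝ × ℝ | v.1 * v.2 = 0 ∧ 0 ≤ v.2} := by
  intro v hv
  rcases hx.1.eq_or_lt with h0 | hpos
  · simp [snd_eq_zero_of_mem_frechetNormalCone_Kv h0.symm hv]
  have hx2 : x.2 ≤ 0 := nonpos_of_mul_nonpos_right hx.2 hpos
  have key (c : ℝ) (hc : -1 ≤ c) : (c, 0) ∈ tangentCone Kv x :=
    mem_tangentCone_of_forall_add_smul_mem hpos fun t ht htx => by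
      have : 0 ≤ x.1 + t * c := by nlinarith
      simpa [Kv, this] using mul_nonpos_of_nonneg_of_nonpos this hx2
  have h₁ := hv _ (key 1 (by norm_num))
  have h₂ := hv _ (key (-1) le_rfl)
  have hdown : ((0, -1) : ℝ × ℝ) ∈ tangentCone Kv x :=
    mem_tangentCone_of_forall_add_smul_mem one_pos fun t ht _ => by
      have : x.1 * (x.2 + -t) ≤ 0 := mul_nonpos_of_nonneg_of_nonpos hpos.le (by linarith)
      simpa [Kv, hpos.le] using this
  have h₃ := hv _ hdown
  simp only at h₁ h₂ h₃
  have hv1 : v.1 = 0 := by linarith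
  exact ⟨by simp [hv1], by linarith⟩

theorem limitingNormalCone_Kv_zero :
    limitingNormalCone Kv 0 = {v : ℝ × ℝ | v.1 * v.2 = 0 ∧ 0 ≤ v.2} := by
  refine Set.Subset.antisymm ?_ ?_
  · rintro v ⟨xs, vs, hM, -, hvs, hv⟩
    have hclosed : IsClosed {v : ℝ × ℝ | v.1 * v.2 = 0 ∧ 0 ≤ v.2} :=
      (isClosed_eq (continuous_fst.mul continuous_snd) continuous_const).inter
        (isClosed_le continuous_const continuous_snd)
    exact hclosed.mem_of_tendsto hv
      (Eventually.of_forall fun k => frechetNormalCone_Kv_subset (hM k) (hvs k))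
  · rintro v ⟨hv, hv2⟩
    have hlim := tendsto_one_div_add_atTop_nhds_zero_nat (𝕜 := ℝ)
    have hpos : ∀ k : ℕ, 0 < 1 / ((k : ℝ) + 1) := fun k => Nat.one_div_pos_of_nat
    rcases mul_eq_zero.1 hv with h | h
    · refine ⟨fun k => (1 / ((k : ℝ) + 1), 0), fun _ => v, fun k => ⟨(hpos k).le, by simp⟩,
        hlim.prodMk_nhds tendsto_const_nhds, fun k w hw => ?_, tendsto_const_nhds⟩
      simpa [h] using
        mul_nonpos_of_nonneg_of_nonpos hv2 (tangentCone_Kv_subset_of_fst_pos (hpos k) hw)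
    · refine ⟨fun k => (0, 1 / ((k : ℝ) + 1)), fun _ => v, fun k => ⟨le_rfl, by simp⟩,
        tendsto_const_nhds.prodMk_nhds hlim, fun k w hw => ?_, tendsto_const_nhds⟩
      have hw1 : w.1 = 0 := tangentCone_Kv_subset_of_snd_pos (hpos k) hw
      simp [h, hw1]

theorem clarkeNormalCone_Kv_zero : clarkeNormalCone Kv 0 = {v : ℝ × ℝ | 0 ≤ v.2} := by
  rw [clarkeNormalCone, limitingNormalCone_Kv_zero]
  refine Set.Subset.antisymm ?_ fun v hv => subset_closure ?_
  · exact closure_minimal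
      (convexHull_min (fun v hv => hv.2)
        (convex_halfSpace_ge (LinearMap.snd ℝ ℝ ℝ).isLinear 0))
      (isClosed_le continuous_const continuous_snd)
  · have hv' : (0 : ℝ) ≤ v.2 := hv
    have h := convex_convexHull ℝ {v : ℝ × ℝ | v.1 * v.2 = 0 ∧ 0 ≤ v.2}
      (subset_convexHull ℝ _ (show ((2 * v.1, 0) : ℝ × ℝ) ∈ _ by simp))
      (subset_convexHull ℝ _ (show ((0, 2 * v.2) : ℝ × ℝ) ∈ _ by simp [hv']))
      (show (0 : ℝ) ≤ 1 / 2 by norm_num) (show (0 : ℝ) ≤ 1 / 2 by norm_num) (by norm_num)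
    convert h using 1
    ext <;> simp

/-- Fréchet, limiting and Clarke normal cones of K_v at the origin. -/
theorem normal_cones_Kv_at_origin :
    frechetNormalCone Kv 0 = {v : ℝ × ℝ | v.1 ≤ 0 ∧ v.2 = 0} ∧
    limitingNormalCone Kv 0 = {v : ℝ × ℝ | v.1 * v.2 = 0 ∧ 0 ≤ v.2} ∧
    clarkeNormalCone Kv 0 = {v : ℝ × ℝ | 0 ≤ v.2} :=
  ⟨frechetNormalCone_Kv_zero, limitingNormalCone_Kv_zero, clarkeNormalCone_Kv_zero⟩
end
end

section
/- Let x̄ ∈ M_c be biactive, let SNO-LICQ hold at x̄, and let x̄ be a local minimizer of f on M_c. Then there exist multipliers λ_{1,i} ≥ 0 and λ_{2,i} ≥ 0, i = 1,…,m, such that ∇f(x̄) = Σ_{i=1}^m λ_{1,i}∇F_{1,i}(x̄) + λ_{2,i}∇F_{2,i}(x̄). -/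
open Filter Topology
open scoped RealInnerProductSpace

noncomputable section

/-- A strictly differentiable map whose derivative has a right inverse `R` admits a local section
with derivative `R`. -/
theorem HasStrictFDerivAt.exists_local_section {E F : Type*} [NormedAddCommGroup E]
    [NormedSpace ℝ E] [NormedAddCommGroup F] [NormedSpace ℝ F] [CompleteSpace F]
    {G : E → F} {G' : E →L[ℝ] F} {R : F →L[ℝ] E} {x : E} (hG : HasStrictFDerivAt G G' x)
    (hR : G'.comp R = ContinuousLinearMap.id ℝ F) :
    ∃ s : F → E, s (G x) = x ∧ HasFDerivAt s R (G x) ∧ ∀ᶠ w in 𝓝 (G x), G (s w) = w := by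
  have hx : x + R 0 = x := by simp
  have hh : HasStrictFDerivAt (fun w => G (x + R w))
      ((ContinuousLinearEquiv.refl ℝ F : F ≃L[ℝ] F) : F →L[ℝ] F) 0 := by
    have h1 : HasStrictFDerivAt G G' (x + R 0) := by rwa [hx]
    have h2 : HasStrictFDerivAt (fun w => x + R w) R 0 := R.hasStrictFDerivAt.const_add x
    have h3 := h1.comp (0 : F) h2
    rw [hR] at h3
    exact h3
  have hs0 := hh.localInverse_apply_image
  have hs' := hh.to_localInverse.hasFDerivAt
  have hs := hh.eventually_right_inverse
  simp only [hx] at hs0 hs' hs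
  refine ⟨fun w => x + R (hh.localInverse _ _ _ w), by simp [hs0], ?_, hs⟩
  exact (R.hasFDerivAt.comp (G x) hs').const_add x

/-- Finitely many linearly independent functionals form a surjective map. -/
theorem ContinuousLinearMap.range_pi_eq_top_of_linearIndependent {ι E : Type*} [Fintype ι]
    [NormedAddCommGroup E] [NormedSpace ℝ E] {g : ι → E →L[ℝ] ℝ} (hg : LinearIndependent ℝ g) :
    (ContinuousLinearMap.pi g).range = ⊤ := by
  classical
  by_contra hne
  obtain ⟨φ, hφ, hle⟩ := Submodule.exists_le_ker_of_lt_top _ (lt_top_iff_ne_top.2 hne)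
  refine hφ (LinearMap.pi_ext' fun i => LinearMap.ext_ring ?_)
  refine Fintype.linearIndependent_iff.1 hg (fun i => φ (Pi.single i 1)) ?_ i
  ext y
  have hy : φ (fun i => g i y) = 0 := hle ⟨y, rfl⟩
  rw [LinearMap.pi_apply_eq_sum_univ φ] at hy
  have hsingle : ∀ i : ι, (fun j : ι => if i = j then (1 : ℝ) else 0) = Pi.single i 1 := fun i => by
    ext j
    rw [Pi.single_apply]
    exact if_congr eq_comm rfl rfl
  simp only [hsingle, smul_eq_mul] at hy
  rw [sum_apply, zero_apply, ← hy]
  exact Finset.sum_congr rfl fun i _ => mul_comm _ _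

/-- Let `φ` have a local minimum at a common zero `x` of the functions `G i`, on a set containing
all points at which the `G i` are nonnegative and at most one of them is nonzero. If the derivatives
of the `G i` at `x` are linearly independent, then `φ` has nonnegative Lagrange multipliers. -/
theorem IsLocalMinOn.exists_nonneg_multipliers {ι E : Type*} [Fintype ι]
    [NormedAddCommGroup E] [NormedSpace ℝ E] [CompleteSpace E] {G : ι → E → ℝ}
    {G' : ι → E →L[ℝ] ℝ} {φ : E → ℝ} {φ' : E →L[ℝ] ℝ} {S : Set E} {x : E}
    (hmin : IsLocalMinOn φ S x) (hG : ∀ i, HasStrictFDerivAt (G i) (G' i) x)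
    (hφ : HasStrictFDerivAt φ φ' x) (hx : ∀ i, G i x = 0) (hli : LinearIndependent ℝ G')
    (hS : ∀ y, (∀ i, 0 ≤ G i y) → (∀ i j, i ≠ j → G i y * G j y = 0) → y ∈ S) :
    ∃ c : ι → ℝ, (∀ i, 0 ≤ c i) ∧ φ' = ∑ i, c i • G' i := by
  classical
  have hmin₀ : IsLocalMinOn φ {y | ∀ i, G i y = G i x} x :=
    hmin.on_subset fun y hy => by
      simp only [hx, Set.mem_ofPred_eq] at hy
      exact hS y (fun i => (hy i).ge) fun i j _ => by simp [hy]
  obtain ⟨Λ, Λ₀, hne, hsum⟩ :=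
    IsLocalExtrOn.exists_multipliers_of_hasStrictFDerivAt (.inl hmin₀) hG hφ
  have hΛ₀ : Λ₀ ≠ 0 := by
    rintro rfl
    rw [zero_smul, add_zero] at hsum
    exact hne (Prod.ext (funext (Fintype.linearIndependent_iff.1 hli Λ hsum)) rfl)
  have hφ' : φ' = ∑ i, (-Λ₀⁻¹ * Λ i) • G' i := by
    simp only [mul_smul, ← Finset.smul_sum]
    rw [eq_neg_of_add_eq_zero_left hsum, smul_neg, neg_smul, neg_neg, inv_smul_smul₀ hΛ₀]
  refine ⟨_, fun j => ?_, hφ'⟩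
  have hpi : HasStrictFDerivAt (fun y i => G i y) (ContinuousLinearMap.pi G') x :=
    hasStrictFDerivAt_pi.2 hG
  have hx₀ : (fun i => G i x) = 0 := funext hx
  obtain ⟨R, hR⟩ := ContinuousLinearMap.exists_rightInverse_of_surjective _
    (ContinuousLinearMap.range_pi_eq_top_of_linearIndependent hli)
  obtain ⟨s, hsx, hs', hs⟩ := hpi.exists_local_section hR
  rw [hx₀] at hsx hs' hs
  have hGR : ∀ i, G' i (R (Pi.single j 1)) = (Pi.single j 1 : ι → ℝ) i := fun i =>
    congrFun (DFunLike.congr_fun hR (Pi.single j 1)) i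
  set T : Set (ι → ℝ) := (fun t : ℝ => t • Pi.single j (1 : ℝ)) '' Set.Ici 0
  have hT : ∀ w ∈ T, (∀ i, G i (s w) = w i) → s w ∈ S := by
    rintro _ ⟨t, ht, rfl⟩ hw
    refine hS _ (fun i => ?_) fun i k hik => ?_
    · rw [hw]
      exact mul_nonneg ht (by by_cases h : i = j <;> simp [h])
    · rw [hw, hw]
      rcases eq_or_ne i j with rfl | hij
      · simp [hik.symm]
      · simp [hij]
  have hlocal : IsLocalMinOn (φ ∘ s) T 0 := by
    have htend : Tendsto s (𝓝[T] 0) (𝓝[S] x) := by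
      refine tendsto_nhdsWithin_iff.2 ⟨?_, ?_⟩
      · simpa only [hsx] using hs'.continuousAt.tendsto.mono_left nhdsWithin_le_nhds
      · filter_upwards [nhdsWithin_le_nhds hs, self_mem_nhdsWithin] with w hw hwT
        exact hT w hwT (congrFun hw)
    have := htend.eventually hmin
    simpa only [IsLocalMinOn, IsMinFilter, Function.comp_apply, hsx] using this
  have hderiv : HasFDerivAt (φ ∘ s) (φ'.comp R) 0 :=
    HasFDerivAt.comp 0 (by simpa only [hsx] using hφ.hasFDerivAt) hs'
  have hcone : Pi.single j (1 : ℝ) ∈ posTangentConeAt T 0 := by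
    refine mem_posTangentConeAt_of_frequently_mem (Eventually.frequently ?_)
    filter_upwards [self_mem_nhdsWithin] with t ht
    rw [zero_add]
    exact ⟨t, Set.Ioi_subset_Ici_self ht, rfl⟩
  have hnonneg := hlocal.hasFDerivWithinAt_nonneg hderiv.hasFDerivWithinAt hcone
  rw [ContinuousLinearMap.comp_apply, hφ'] at hnonneg
  simpa [hGR, Pi.single_apply] using hnonneg

/-- MPCC: at a biactive local minimizer satisfying SNO-LICQ, the gradient of f is a
nonnegative combination of the gradients of the biactive constraint functions. -/
theorem mpcc_local_min_multipliers {n m : ℕ}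
    (f : EuclideanSpace ℝ (Fin n) → ℝ) (F1 F2 : Fin m → EuclideanSpace ℝ (Fin n) → ℝ)
    (hf : ContDiff ℝ 1 f) (hF1 : ∀ i, ContDiff ℝ 1 (F1 i)) (hF2 : ∀ i, ContDiff ℝ 1 (F2 i))
    (x : EuclideanSpace ℝ (Fin n))
    (hbi : ∀ i, F1 i x = 0 ∧ F2 i x = 0)
    (hLICQ : LinearIndependent ℝ
      (Sum.elim (fun i => gradient (F1 i) x) (fun i => gradient (F2 i) x)))
    (hmin : IsLocalMinOn f
      {y | ∀ i, F1 i y * F2 i y = 0 ∧ 0 ≤ F1 i y ∧ 0 ≤ F2 i y} x) :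
    ∃ l1 l2 : Fin m → ℝ, (∀ i, 0 ≤ l1 i ∧ 0 ≤ l2 i) ∧
      gradient f x = ∑ i, (l1 i • gradient (F1 i) x + l2 i • gradient (F2 i) x) := by
  have hstrict : ∀ g : EuclideanSpace ℝ (Fin n) → ℝ, ContDiff ℝ 1 g →
      HasStrictFDerivAt g (fderiv ℝ g x) x := fun g hg =>
    hg.contDiffAt.hasStrictFDerivAt one_ne_zero
  let D := (InnerProductSpace.toDual ℝ (EuclideanSpace ℝ (Fin n))).toLinearEquiv
  have hD : ∀ g, D (gradient g x) = fderiv ℝ g x := fun g => toDual_gradient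
  let G : Fin m ⊕ Fin m → EuclideanSpace ℝ (Fin n) → ℝ := Sum.elim F1 F2
  have hli : LinearIndependent ℝ fun i => fderiv ℝ (G i) x := by
    have heq : (fun i => fderiv ℝ (G i) x) = D ∘ Sum.elim (fun i => gradient (F1 i) x)
        (fun i => gradient (F2 i) x) := by
      ext1 (i | i) <;> exact (hD _).symm
    rw [heq]
    exact hLICQ.map' D.toLinearMap D.ker
  obtain ⟨c, hc, hsum⟩ := hmin.exists_nonneg_multipliers (G := G)
    (by rintro (i | i); exacts [hstrict _ (hF1 i), hstrict _ (hF2 i)]) (hstrict f hf)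
    (by rintro (i | i); exacts [(hbi i).1, (hbi i).2]) hli
    fun y hy hy' i => ⟨hy' (.inl i) (.inr i) Sum.inl_ne_inr, hy (.inl i), hy (.inr i)⟩
  refine ⟨fun i => c (.inl i), fun i => c (.inr i), fun i => ⟨hc _, hc _⟩, D.injective ?_⟩
  simp only [map_sum, map_add, map_smul, hD, hsum, Fintype.sum_sum_type, Finset.sum_add_distrib]
  rfl
end
end

section
/- Let x̄ ∈ M_v be biactive, let SNO-LICQ hold at x̄, and let x̄ be a local minimizer of f on M_v. Then there exist multipliers λ_{1,i} ≥ 0, i = 1,…,m, such that ∇f(x̄) = Σ_{i=1}^m λ_{1,i}∇F_{1,i}(x̄) (that is, there are multipliers λ_{1,i} ≥ 0 and λ_{2,i} = 0 for the gradient representation ∇f(x̄) = Σ_i λ_{1,i}∇F_{1,i}(x̄) + λ_{2,i}∇F_{2,i}(x̄)). -/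
open Filter Topology
open scoped RealInnerProductSpace

noncomputable section

/-- Linearly independent continuous linear functionals are jointly surjective. -/
lemma LinearIndependent.surjective_continuousLinearMap_pi {ι E : Type*} [Fintype ι]
    [NormedAddCommGroup E] [NormedSpace ℝ E] {g' : ι → E →L[ℝ] ℝ}
    (h : LinearIndependent ℝ g') : Function.Surjective (ContinuousLinearMap.pi g') := by
  classical
  have key : Function.Surjective (ContinuousLinearMap.pi g' : E →ₗ[ℝ] ι → ℝ) := by
    rw [← LinearMap.dualMap_injective_iff, injective_iff_map_eq_zero]
    intro φ hφ
    have hsum : ∑ i, φ (Pi.single i 1) • g' i = 0 := by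
      ext d
      have := LinearMap.congr_fun hφ d
      have hsingle : ∀ i : ι, (fun j => if i = j then (1 : ℝ) else 0) = Pi.single i 1 :=
        fun i => by ext j; simp [Pi.single_apply, eq_comm]
      rw [LinearMap.dualMap_apply, LinearMap.pi_apply_eq_sum_univ] at this
      simpa [mul_comm, hsingle] using this
    have hz := Fintype.linearIndependent_iff.1 h _ hsum
    refine LinearMap.pi_ext' fun i => LinearMap.ext_ring ?_
    simpa using hz i
  exact key

/-- Lagrange multipliers for minimization over a preimage `{y | g y ∈ C}` with linearly
independent constraint derivatives: the multiplier vector is nonnegative on every vector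
reachable from `0` by a segment in `C`. -/
theorem IsLocalMinOn.exists_multipliers_of_linearIndependent {ι E : Type*} [Fintype ι]
    [NormedAddCommGroup E] [NormedSpace ℝ E] [CompleteSpace E]
    {f : E → ℝ} {g : ι → E → ℝ} {f' : E →L[ℝ] ℝ} {g' : ι → E →L[ℝ] ℝ} {x : E}
    {C : Set (ι → ℝ)} (hf : HasStrictFDerivAt f f' x)
    (hg : ∀ i, HasStrictFDerivAt (g i) (g' i) x) (hgx : ∀ i, g i x = 0) (hC : 0 ∈ C)
    (hLI : LinearIndependent ℝ g') (hmin : IsLocalMinOn f {y | (fun i => g i y) ∈ C} x) :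
    ∃ l : ι → ℝ, f' = ∑ i, l i • g' i ∧
      ∀ v, segment ℝ 0 v ⊆ C → 0 ≤ ∑ i, l i * v i := by
  obtain ⟨l, hl⟩ : ∃ l : ι → ℝ, f' = ∑ i, l i • g' i := by
    have hextr : IsLocalExtrOn f {y | ∀ i, g i y = g i x} x := by
      refine Or.inl (hmin.on_subset fun y hy => ?_)
      have : (fun i => g i y) = 0 := funext fun i => (hy i).trans (hgx i)
      simpa [this] using hC
    obtain ⟨L, L₀, hne, hsum⟩ := hextr.exists_multipliers_of_hasStrictFDerivAt hg hf
    have hL₀ : L₀ ≠ 0 := by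
      rintro rfl
      have := Fintype.linearIndependent_iff.1 hLI L (by simpa using hsum)
      exact hne (Prod.ext (funext this) rfl)
    refine ⟨fun i => -(L₀⁻¹ * L i), ?_⟩
    have : f' = -(L₀⁻¹ • ∑ i, L i • g' i) := by
      rw [eq_neg_of_add_eq_zero_left hsum, smul_neg, neg_neg, inv_smul_smul₀ hL₀]
    rw [this, Finset.smul_sum, ← Finset.sum_neg_distrib]
    exact Finset.sum_congr rfl fun i _ => by ext d; simp [mul_assoc]
  refine ⟨l, hl, fun v hv => ?_⟩
  obtain ⟨R₀, hR₀⟩ := LinearMap.exists_rightInverse_of_surjective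
    (ContinuousLinearMap.pi g' : E →ₗ[ℝ] ι → ℝ)
    (LinearMap.range_eq_top.2 hLI.surjective_continuousLinearMap_pi)
  set R : (ι → ℝ) →L[ℝ] E := LinearMap.toContinuousLinearMap R₀
  have hR : ∀ w i, g' i (R w) = w i := fun w i => congrFun (LinearMap.congr_fun hR₀ w) i
  have hlin : HasStrictFDerivAt (fun w => x + R w) R 0 := R.hasStrictFDerivAt.const_add x
  have hG : HasStrictFDerivAt (fun w i => g i (x + R w))
      ((ContinuousLinearEquiv.refl ℝ (ι → ℝ) : (ι → ℝ) ≃L[ℝ] (ι → ℝ)) :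
        (ι → ℝ) →L[ℝ] (ι → ℝ)) 0 := by
    rw [hasStrictFDerivAt_pi']
    intro i
    have := HasStrictFDerivAt.comp (0 : ι → ℝ) (g := g i) (g' := g' i)
      (by simpa using hg i) hlin
    convert this using 1
    ext w
    simp [hR]
  have hG0 : (fun i => g i (x + R 0)) = 0 := by ext i; simp [hgx]
  set s := hG.localInverse _ _ _
  have hs : HasStrictFDerivAt s (ContinuousLinearMap.id ℝ (ι → ℝ)) 0 := by
    have := hG.to_localInverse
    rw [hG0] at this
    exact this
  have hs0 : s 0 = 0 := by simpa only [hG0] using hG.localInverse_apply_image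
  have hright : ∀ᶠ w in 𝓝 (0 : ι → ℝ), (fun i => g i (x + R (s w))) = w := by
    simpa only [hG0] using hG.eventually_right_inverse
  have hγ : HasStrictFDerivAt (fun w => x + R (s w)) R 0 :=
    (R.hasStrictFDerivAt.comp (0 : ι → ℝ) hs).const_add x
  have hγ0 : x + R (s 0) = x := by simp [hs0]
  have hfγ : HasFDerivAt (fun w => f (x + R (s w))) (f'.comp R) 0 := by
    refine HasFDerivAt.comp (0 : ι → ℝ) (g := f) ?_ hγ.hasFDerivAt
    rw [hγ0]
    exact hf.hasFDerivAt
  have hminγ : IsLocalMinOn (fun w => f (x + R (s w))) C 0 := by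
    have hev := eventually_nhdsWithin_iff.1 hmin
    have hcont : Tendsto (fun w => x + R (s w)) (𝓝 0) (𝓝 x) := by
      simpa only [hγ0] using hγ.continuousAt.tendsto
    refine eventually_nhdsWithin_iff.2 ?_
    filter_upwards [hcont.eventually hev, hright] with w hw hr hwC
    simp only [hγ0]
    exact hw (by simpa only [Set.mem_ofPred_eq, hr] using hwC)
  have hpos := hminγ.hasFDerivWithinAt_nonneg hfγ.hasFDerivWithinAt
    (mem_posTangentConeAt_of_segment_subset (y := v) (by simpa using hv))
  simpa [hl, hR] using hpos

/-- MPVC: at a biactive local minimizer satisfying SNO-LICQ, the gradient of f is a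
nonnegative combination of the gradients ∇F_{1,i}(x̄) (i.e. λ_{1,i} ≥ 0, λ_{2,i} = 0). -/
theorem mpvc_local_min_multipliers {n m : ℕ}
    (f : EuclideanSpace ℝ (Fin n) → ℝ) (F1 F2 : Fin m → EuclideanSpace ℝ (Fin n) → ℝ)
    (hf : ContDiff ℝ 1 f) (hF1 : ∀ i, ContDiff ℝ 1 (F1 i)) (hF2 : ∀ i, ContDiff ℝ 1 (F2 i))
    (x : EuclideanSpace ℝ (Fin n))
    (hbi : ∀ i, F1 i x = 0 ∧ F2 i x = 0)
    (hLICQ : LinearIndependent ℝ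
      (Sum.elim (fun i => gradient (F1 i) x) (fun i => gradient (F2 i) x)))
    (hmin : IsLocalMinOn f
      {y | ∀ i, 0 ≤ F1 i y ∧ F1 i y * F2 i y ≤ 0} x) :
    ∃ l1 : Fin m → ℝ, (∀ i, 0 ≤ l1 i) ∧
      gradient f x = ∑ i, l1 i • gradient (F1 i) x := by
  classical
  let C : Set (Fin m ⊕ Fin m → ℝ) := {w | ∀ i, 0 ≤ w (.inl i) ∧ w (.inl i) * w (.inr i) ≤ 0}
  let g : Fin m ⊕ Fin m → EuclideanSpace ℝ (Fin n) → ℝ := Sum.elim F1 F2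
  have hg : ∀ i, HasStrictFDerivAt (g i) (fderiv ℝ (g i) x) x := by
    rintro (i | i)
    · exact (hF1 i).contDiffAt.hasStrictFDerivAt one_ne_zero
    · exact (hF2 i).contDiffAt.hasStrictFDerivAt one_ne_zero
  have hLI : LinearIndependent ℝ fun i => fderiv ℝ (g i) x := by
    rw [Fintype.linearIndependent_iff] at hLICQ ⊢
    refine fun c hc => hLICQ c ?_
    have := congrArg (InnerProductSpace.toDual ℝ (EuclideanSpace ℝ (Fin n))).symm hc
    simpa [Fintype.sum_sum_type, gradient, g] using this
  obtain ⟨l, hl, hpos⟩ := IsLocalMinOn.exists_multipliers_of_linearIndependent (C := C)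
    (hf.contDiffAt.hasStrictFDerivAt one_ne_zero) hg
    (by rintro (i | i); exacts [(hbi i).1, (hbi i).2]) (by simp [C]) hLI hmin
  have hsingle : ∀ j (c : ℝ), (∀ t : ℝ, 0 ≤ t → Pi.single j (t * c) ∈ C) → 0 ≤ l j * c := by
    intro j c hjc
    have := hpos (Pi.single j c) (by
      rw [segment_eq_image]
      rintro _ ⟨t, ht, rfl⟩
      simpa [← Pi.single_smul] using hjc t ht.1)
    simpa [Pi.single_apply] using this
  have hl1 : ∀ i, 0 ≤ l (.inl i) := fun i => by
    simpa using hsingle (.inl i) 1 fun t ht k => by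
      by_cases h : k = i <;> simp [h, ht]
  have hl2 : ∀ i, l (.inr i) = 0 := fun i => by
    have h : ∀ c, 0 ≤ l (.inr i) * c := fun c => hsingle (.inr i) c fun t ht k => by simp
    linarith [h 1, h (-1)]
  refine ⟨fun i => l (.inl i), hl1, ?_⟩
  simp only [gradient]
  rw [hl]
  simp [Fintype.sum_sum_type, hl2, g]
end
end

section
/- Let x̄ ∈ M_o be biactive, let SNO-LICQ hold at x̄, and let x̄ be a local minimizer of f on M_o. Then there exist multipliers λ_{2,i} ≥ 0, i = 1,…,m, such that ∇f(x̄) = Σ_{i=1}^m λ_{2,i}∇F_{2,i}(x̄) (that is, there are multipliers λ_{1,i} = 0 and λ_{2,i} ≥ 0 for the gradient representation ∇f(x̄) = Σ_i λ_{1,i}∇F_{1,i}(x̄) + λ_{2,i}∇F_{2,i}(x̄)). -/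
open Filter Topology
open scoped RealInnerProductSpace

noncomputable section

section Curve

variable {E : Type*} [NormedAddCommGroup E] [InnerProductSpace ℝ E]

/-- A finite linearly independent family in a finite-dimensional inner product space has a biorthogonal family. -/
theorem exists_biorthogonal_of_linearIndependent [FiniteDimensional ℝ E]
    {ι : Type*} [Fintype ι] [DecidableEq ι] {v : ι → E} (hv : LinearIndependent ℝ v) :
    ∃ d : ι → E, ∀ j k, ⟪v j, d k⟫ = if j = k then 1 else 0 := by
  have := FiniteDimensional.complete ℝ E
  obtain ⟨g, hg⟩ := (Fintype.linearCombination ℝ v).exists_leftInverse_of_injective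
    (LinearMap.ker_eq_bot.2 hv.fintypeLinearCombination_injective)
  refine ⟨fun k => (InnerProductSpace.toDual ℝ E).symm
    (LinearMap.toContinuousLinearMap ((LinearMap.proj k).comp g)), fun j k => ?_⟩
  have h : g (v j) = Pi.single j 1 := by
    simpa [Fintype.linearCombination_apply_single] using LinearMap.congr_fun hg (Pi.single j 1)
  rw [real_inner_comm, InnerProductSpace.toDual_symm_apply]
  simp [h, Pi.single_apply, eq_comm]

/-- If the gradients of `G j` at `x` admit a biorthogonal family, every direction `e` is the
velocity of a curve through `x` along which each `G j` is linear. -/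
theorem exists_curve_of_biorthogonal [CompleteSpace E] {ι : Type*} [Fintype ι] [DecidableEq ι]
    {G : ι → E → ℝ} {v d : ι → E} {x : E}
    (hG : ∀ j, HasStrictFDerivAt (G j) (innerSL ℝ (v j)) x) (hG0 : ∀ j, G j x = 0)
    (hd : ∀ j k, ⟪v j, d k⟫ = if j = k then 1 else 0) (e : E) :
    ∃ y : ℝ → E, y 0 = x ∧ HasDerivAt y e 0 ∧
      ∀ᶠ t in 𝓝 (0 : ℝ), ∀ j, G j (y t) = t * ⟪v j, e⟫ := by
  let Ψ : E → E := fun y => (y - x) + ∑ j, (G j y - innerSL ℝ (v j) (y - x)) • d j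
  have hΨ : HasStrictFDerivAt Ψ ((ContinuousLinearEquiv.refl ℝ E : E ≃L[ℝ] E) : E →L[ℝ] E) x := by
    have hsub : HasStrictFDerivAt (fun y : E => y - x) (ContinuousLinearMap.id ℝ E) x :=
      (hasStrictFDerivAt_id x).sub_const x
    have hsum := HasStrictFDerivAt.fun_sum (u := Finset.univ) fun j _ =>
      ((hG j).sub ((innerSL ℝ (v j)).hasStrictFDerivAt.comp x hsub)).smul_const (d j)
    refine (hsub.add hsum).congr_fderiv ?_
    ext z
    simp
  have hΨx : Ψ x = 0 := by simp [Ψ, hG0]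
  have hline : HasDerivAt (fun t : ℝ => t • e) e 0 := by
    simpa using (hasDerivAt_id (0 : ℝ)).smul_const e
  have hinv := hΨ.to_localInverse.hasFDerivAt
  have hinv0 : hΨ.localInverse Ψ _ x 0 = x := by
    simpa [hΨx] using hΨ.localInverse_apply_image
  have hright : ∀ᶠ t in 𝓝 (0 : ℝ), Ψ (hΨ.localInverse Ψ _ x (t • e)) = t • e := by
    have hten : Tendsto (fun t : ℝ => t • e) (𝓝 0) (𝓝 (Ψ x)) := by
      simpa [hΨx] using hline.continuousAt.tendsto
    exact hten.eventually hΨ.eventually_right_inverse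
  refine ⟨fun t => hΨ.localInverse Ψ _ x (t • e), by simpa using hinv0, ?_, ?_⟩
  · rw [hΨx] at hinv
    rw [← zero_smul ℝ e] at hinv
    simpa [Function.comp_def] using hinv.comp_hasDerivAt (0 : ℝ) hline
  · filter_upwards [hright] with t ht j
    have h := congrArg (fun z => ⟪v j, z⟫) ht
    simpa [Ψ, inner_add_right, inner_sum, inner_smul_right, hd] using h

/-- The derivative of a function along a curve that starts at a local minimizer on `s` and stays in
`s` for small positive times is nonnegative. -/
theorem IsLocalMinOn.inner_nonneg_of_curve [CompleteSpace E] {f : E → ℝ} {s : Set E} {x g e : E} {y : ℝ → E}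
    (hmin : IsLocalMinOn f s x) (hf : HasGradientAt f g x) (hy0 : y 0 = x)
    (hy : HasDerivAt y e 0) (hys : ∀ᶠ t in 𝓝[>] (0 : ℝ), y t ∈ s) : 0 ≤ ⟪g, e⟫ := by
  have hten : Tendsto y (𝓝[>] 0) (𝓝[s] x) := by
    refine tendsto_nhdsWithin_iff.2 ⟨?_, hys⟩
    simpa [hy0] using hy.continuousAt.tendsto.mono_left nhdsWithin_le_nhds
  have hder : HasDerivAt (fun t => f (y t)) ⟪g, e⟫ 0 := by
    have hf' := hf.hasFDerivAt
    rw [← hy0] at hf'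
    simpa [Function.comp_def] using hf'.comp_hasDerivAt (0 : ℝ) hy
  refine ge_of_tendsto ((hasDerivAt_iff_tendsto_slope.1 hder).mono_left
    (nhdsWithin_mono 0 fun t (ht : t ∈ Set.Ioi (0 : ℝ)) => (Set.mem_Ioi.1 ht).ne')) ?_
  filter_upwards [hten.eventually hmin, self_mem_nhdsWithin] with t ht (ht0 : 0 < t)
  rw [slope_def_field, hy0]
  exact div_nonneg (sub_nonneg.2 ht) (by simpa using ht0.le)

/-- Let `d` be biorthogonal to `v`. If `g` is orthogonal to every vector orthogonal to all `v j`, then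
`g` is the combination of the `v j` with coefficients `⟪g, d j⟫`. -/
theorem eq_sum_inner_smul_of_biorthogonal {ι : Type*} [Fintype ι] [DecidableEq ι]
    {v d : ι → E} (hd : ∀ j k, ⟪v j, d k⟫ = if j = k then 1 else 0) {g : E}
    (hg : ∀ w, (∀ j, ⟪v j, w⟫ = 0) → ⟪g, w⟫ = 0) : g = ∑ j, ⟪g, d j⟫ • v j := by
  refine ext_inner_right ℝ fun w => ?_
  have h := hg (w - ∑ j, ⟪v j, w⟫ • d j) fun j => by
    simp [inner_sub_right, inner_sum, inner_smul_right, hd]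
  rw [inner_sub_right, sub_eq_zero] at h
  rw [h]
  simp [inner_sum, sum_inner, inner_smul_right, real_inner_smul_left, mul_comm]

end Curve

/-- MPOC: at a biactive local minimizer satisfying SNO-LICQ, the gradient of f is a
nonnegative combination of the gradients ∇F_{2,i}(x̄) (i.e. λ_{1,i} = 0, λ_{2,i} ≥ 0). -/
theorem mpoc_local_min_multipliers {n m : ℕ}
    (f : EuclideanSpace ℝ (Fin n) → ℝ) (F1 F2 : Fin m → EuclideanSpace ℝ (Fin n) → ℝ)
    (hf : ContDiff ℝ 1 f) (hF1 : ∀ i, ContDiff ℝ 1 (F1 i)) (hF2 : ∀ i, ContDiff ℝ 1 (F2 i))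
    (x : EuclideanSpace ℝ (Fin n))
    (hbi : ∀ i, F1 i x = 0 ∧ F2 i x = 0)
    (hLICQ : LinearIndependent ℝ
      (Sum.elim (fun i => gradient (F1 i) x) (fun i => gradient (F2 i) x)))
    (hmin : IsLocalMinOn f
      {y | ∀ i, F1 i y * F2 i y = 0 ∧ 0 ≤ F2 i y} x) :
    ∃ l2 : Fin m → ℝ, (∀ i, 0 ≤ l2 i) ∧
      gradient f x = ∑ i, l2 i • gradient (F2 i) x := by
  set v : Fin m ⊕ Fin m → EuclideanSpace ℝ (Fin n) :=
    Sum.elim (fun i => gradient (F1 i) x) (fun i => gradient (F2 i) x) with hv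
  have hstrict : ∀ {F : EuclideanSpace ℝ (Fin n) → ℝ}, ContDiff ℝ 1 F →
      HasStrictFDerivAt F (innerSL ℝ (gradient F x)) x := fun {F} hF => by
    refine (hF.contDiffAt.hasStrictFDerivAt one_ne_zero).congr_fderiv ?_
    ext z
    simp [gradient]
  have hG : ∀ j, HasStrictFDerivAt (Sum.elim F1 F2 j) (innerSL ℝ (v j)) x := by
    rintro (i | i)
    exacts [hstrict (hF1 i), hstrict (hF2 i)]
  have hG0 : ∀ j, Sum.elim F1 F2 j x = 0 := by
    rintro (i | i)
    exacts [(hbi i).1, (hbi i).2]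
  obtain ⟨d, hd⟩ := exists_biorthogonal_of_linearIndependent hLICQ
  have hfeas : ∀ e, (∀ i, ⟪v (.inl i), e⟫ * ⟪v (.inr i), e⟫ = 0 ∧ 0 ≤ ⟪v (.inr i), e⟫) →
      0 ≤ ⟪gradient f x, e⟫ := fun e he => by
    obtain ⟨y, hy0, hy, hGy⟩ := exists_curve_of_biorthogonal hG hG0 hd e
    refine hmin.inner_nonneg_of_curve
      ((hf.differentiable one_ne_zero).differentiableAt.hasGradientAt) hy0 hy ?_
    filter_upwards [nhdsWithin_le_nhds hGy, self_mem_nhdsWithin] with t ht (ht0 : 0 < t) i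
    have h1 : F1 i (y t) = t * ⟪v (.inl i), e⟫ := ht (.inl i)
    have h2 : F2 i (y t) = t * ⟪v (.inr i), e⟫ := ht (.inr i)
    rw [h1, h2, mul_mul_mul_comm, (he i).1, mul_zero]
    exact ⟨rfl, mul_nonneg ht0.le (he i).2⟩
  have hzero : ∀ e, (∀ i, ⟪v (.inr i), e⟫ = 0) → ⟪gradient f x, e⟫ = 0 := fun e he => by
    have hpos := hfeas e fun i => by simp [he]
    have hneg := hfeas (-e) fun i => by simp [inner_neg_right, he]
    rw [inner_neg_right] at hneg
    linarith
  refine ⟨fun i => ⟪gradient f x, d (.inr i)⟫, fun i => hfeas _ fun k => ?_, ?_⟩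
  · simp only [hd]
    split_ifs <;> simp_all
  · have hinl : ∀ i, ⟪gradient f x, d (.inl i)⟫ = 0 := fun i => hzero _ fun k => by simp [hd]
    have h := eq_sum_inner_smul_of_biorthogonal hd fun w hw => hzero w fun i => hw (.inr i)
    simpa only [Fintype.sum_sum_type, hinl, zero_smul, Finset.sum_const_zero, zero_add, hv,
      Sum.elim_inr] using h
end
end

section
/- Let x̄ ∈ M_s be biactive, let SNO-LICQ hold at x̄, and let x̄ be a local minimizer of f on M_s. Then ∇f(x̄) = 0. -/
/-- If `f` has a local extremum at `x` on the level set through `x` of a finite family of functions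
whose gradients at `x` are linearly independent, then `∇ f x` lies in the span of these gradients. -/
theorem IsLocalExtrOn.gradient_mem_span {E ι : Type*} [NormedAddCommGroup E]
    [InnerProductSpace ℝ E] [CompleteSpace E] [Finite ι] {f : E → ℝ} {F : ι → E → ℝ} {x : E}
    (hextr : IsLocalExtrOn f {y | ∀ i, F i y = F i x} x)
    (hF : ∀ i, ContDiffAt ℝ 1 (F i) x) (hf : ContDiffAt ℝ 1 f x)
    (hli : LinearIndependent ℝ fun i => gradient (F i) x) :
    gradient f x ∈ Submodule.span ℝ (Set.range fun i => gradient (F i) x) := by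
  have := Fintype.ofFinite ι
  obtain ⟨Λ, Λ₀, hne, hsum⟩ := hextr.exists_multipliers_of_hasStrictFDerivAt
    (fun i => (hF i).hasStrictFDerivAt one_ne_zero) (hf.hasStrictFDerivAt one_ne_zero)
  have hgrad : ∑ i, Λ i • gradient (F i) x + Λ₀ • gradient f x = 0 := by
    simpa [gradient] using congrArg (InnerProductSpace.toDual ℝ E).symm hsum
  have hΛ₀ : Λ₀ ≠ 0 := by
    rintro rfl
    refine hne (Prod.ext (funext ?_) rfl)
    exact Fintype.linearIndependent_iff.1 hli Λ (by simpa using hgrad)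
  have hmem : Λ₀ • gradient f x ∈ Submodule.span ℝ (Set.range fun i => gradient (F i) x) := by
    rw [eq_neg_of_add_eq_zero_right hgrad]
    exact neg_mem (sum_mem fun i _ =>
      Submodule.smul_mem _ _ (Submodule.subset_span (Set.mem_range_self i)))
  exact (Submodule.smul_mem_iff _ hΛ₀).1 hmem

/-- MPSC: at a biactive local minimizer satisfying SNO-LICQ, the gradient of f vanishes. -/
theorem mpsc_local_min_gradient_zero {n m : ℕ}
    (f : EuclideanSpace ℝ (Fin n) → ℝ) (F1 F2 : Fin m → EuclideanSpace ℝ (Fin n) → ℝ)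
    (hf : ContDiff ℝ 1 f) (hF1 : ∀ i, ContDiff ℝ 1 (F1 i)) (hF2 : ∀ i, ContDiff ℝ 1 (F2 i))
    (x : EuclideanSpace ℝ (Fin n))
    (hbi : ∀ i, F1 i x = 0 ∧ F2 i x = 0)
    (hLICQ : LinearIndependent ℝ
      (Sum.elim (fun i => gradient (F1 i) x) (fun i => gradient (F2 i) x)))
    (hmin : IsLocalMinOn f {y | ∀ i, F1 i y * F2 i y = 0} x) :
    gradient f x = 0 := by
  obtain ⟨hli1, hli2, hdisj⟩ := linearIndependent_sum.1 hLICQ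
  have hmin1 : IsLocalMinOn f {y | ∀ i, F1 i y = F1 i x} x :=
    hmin.on_subset fun y hy i => by rw [hy i, (hbi i).1, zero_mul]
  have hmin2 : IsLocalMinOn f {y | ∀ i, F2 i y = F2 i x} x :=
    hmin.on_subset fun y hy i => by rw [hy i, (hbi i).2, mul_zero]
  exact Submodule.disjoint_def.1 hdisj _
    (IsLocalExtrOn.gradient_mem_span (Or.inl hmin1) (fun i => (hF1 i).contDiffAt)
      hf.contDiffAt hli1)
    (IsLocalExtrOn.gradient_mem_span (Or.inl hmin2) (fun i => (hF2 i).contDiffAt)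
      hf.contDiffAt hli2)
end

section
/- Let x̄ ∈ M_d be biactive, let SNO-LICQ hold at x̄, and let x̄ be a local minimizer of f on M_d. Then ∇f(x̄) = 0. -/
open Filter Topology
open scoped RealInnerProductSpace

noncomputable section

/-- In a finite-dimensional inner product space, the inner products with a linearly independent
family can be prescribed arbitrarily. -/
theorem LinearIndependent.exists_inner_eq {ι E : Type*} [NormedAddCommGroup E]
    [InnerProductSpace ℝ E] [FiniteDimensional ℝ E] {v : ι → E} (hv : LinearIndependent ℝ v)
    (c : ι → ℝ) : ∃ a : E, ∀ j, ⟪v j, a⟫ = c j := by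
  obtain ⟨φ, hφ⟩ := LinearMap.exists_extend ((Module.Basis.span hv).constr ℝ c)
  refine ⟨(InnerProductSpace.toDual ℝ E).symm φ.toContinuousLinearMap, fun j => ?_⟩
  rw [real_inner_comm, InnerProductSpace.toDual_symm_apply]
  have h := (Module.Basis.span hv).constr_basis ℝ c j
  rw [← hφ, LinearMap.comp_apply, Submodule.subtype_apply, Module.Basis.span_apply] at h
  exact h

/-- The derivative along the ray `t ↦ x + t • d` is the inner product of the gradient with `d`. -/
theorem DifferentiableAt.hasDerivAt_ray {E : Type*} [NormedAddCommGroup E]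
    [InnerProductSpace ℝ E] [CompleteSpace E] {g : E → ℝ} {x : E}
    (hg : DifferentiableAt ℝ g x) (d : E) :
    HasDerivAt (fun t : ℝ => g (x + t • d)) ⟪gradient g x, d⟫ 0 := by
  have h : HasLineDerivAt ℝ g (fderiv ℝ g x d) x d := hg.hasFDerivAt.hasLineDerivAt d
  rwa [hg.hasGradientAt.hasFDerivAt.fderiv, InnerProductSpace.toDual_apply_apply] at h

/-- A function vanishing at `x` becomes positive along every direction of strict increase. -/
theorem DifferentiableAt.eventually_pos_ray {E : Type*} [NormedAddCommGroup E]
    [InnerProductSpace ℝ E] [CompleteSpace E] {g : E → ℝ} {x : E}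
    (hg : DifferentiableAt ℝ g x) (hx : g x = 0) {d : E} (hd : 0 < ⟪gradient g x, d⟫) :
    ∀ᶠ t : ℝ in 𝓝[>] 0, 0 < g (x + t • d) := by
  have h := (hasDerivAt_iff_tendsto_slope.1 (hg.hasDerivAt_ray d)).eventually_const_lt hd
  filter_upwards [h.filter_mono (nhdsGT_le_nhdsNE 0), self_mem_nhdsWithin] with t ht ht0
  have ht0 : 0 < t := ht0
  simpa [slope_def_field, hx, ht0] using ht

/-- At a local minimizer on `s`, the directional derivative is nonnegative in every direction
whose ray initially stays in `s`. -/
theorem IsLocalMinOn.inner_gradient_nonneg {E : Type*} [NormedAddCommGroup E]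
    [InnerProductSpace ℝ E] [CompleteSpace E] {f : E → ℝ} {s : Set E} {x : E}
    (hmin : IsLocalMinOn f s x) (hf : DifferentiableAt ℝ f x) {d : E}
    (hd : ∀ᶠ t : ℝ in 𝓝[>] 0, x + t • d ∈ s) : 0 ≤ ⟪gradient f x, d⟫ := by
  have hray : Tendsto (fun t : ℝ => x + t • d) (𝓝[>] 0) (𝓝[s] x) := by
    refine tendsto_nhdsWithin_iff.2 ⟨Tendsto.mono_left ?_ nhdsWithin_le_nhds, hd⟩
    have hc : Continuous fun t : ℝ => x + t • d := by fun_prop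
    simpa using hc.tendsto 0
  have h := (hasDerivAt_iff_tendsto_slope.1 (hf.hasDerivAt_ray d)).mono_left
    (nhdsGT_le_nhdsNE 0)
  refine ge_of_tendsto h ?_
  filter_upwards [hray.eventually hmin, self_mem_nhdsWithin] with t ht ht0
  have ht0 : 0 < t := ht0
  rw [slope_def_field]
  exact div_nonneg (by simpa using ht) (by simpa using ht0.le)

/-- MPDC: at a biactive local minimizer satisfying SNO-LICQ, the gradient of f vanishes. -/
theorem mpdc_local_min_gradient_zero {n m : ℕ}
    (f : EuclideanSpace ℝ (Fin n) → ℝ) (F1 F2 : Fin m → EuclideanSpace ℝ (Fin n) → ℝ)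
    (hf : ContDiff ℝ 1 f) (hF1 : ∀ i, ContDiff ℝ 1 (F1 i)) (hF2 : ∀ i, ContDiff ℝ 1 (F2 i))
    (x : EuclideanSpace ℝ (Fin n))
    (hbi : ∀ i, F1 i x = 0 ∧ F2 i x = 0)
    (hLICQ : LinearIndependent ℝ
      (Sum.elim (fun i => gradient (F1 i) x) (fun i => gradient (F2 i) x)))
    (hmin : IsLocalMinOn f {y | ∀ i, 0 ≤ F1 i y ∨ 0 ≤ F2 i y} x) :
    gradient f x = 0 := by
  have hdf := hf.differentiable one_ne_zero x
  have hd1 i := (hF1 i).differentiable one_ne_zero x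
  have hd2 i := (hF2 i).differentiable one_ne_zero x
  -- Split `-∇f(x)` into a direction increasing every `F1 i` and one increasing every `F2 i`.
  obtain ⟨a, ha⟩ := hLICQ.exists_inner_eq
    (Sum.elim (fun _ => 1) (fun i => ⟪gradient (F2 i) x, -gradient f x⟫ - 1))
  have ha1 i : ⟪gradient (F1 i) x, a⟫ = 1 := ha (Sum.inl i)
  have ha2 i : ⟪gradient (F2 i) x, -gradient f x - a⟫ = 1 := by
    have h : ⟪gradient (F2 i) x, a⟫ = ⟪gradient (F2 i) x, -gradient f x⟫ - 1 :=
      ha (Sum.inr i)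
    rw [inner_sub_right, h, sub_sub_cancel]
  have h1 : 0 ≤ ⟪gradient f x, a⟫ := by
    refine hmin.inner_gradient_nonneg hdf ?_
    filter_upwards [eventually_all.2 fun i =>
      (hd1 i).eventually_pos_ray (hbi i).1 (by rw [ha1]; exact one_pos)] with t ht i
    exact Or.inl (ht i).le
  have h2 : 0 ≤ ⟪gradient f x, -gradient f x - a⟫ := by
    refine hmin.inner_gradient_nonneg hdf ?_
    filter_upwards [eventually_all.2 fun i =>
      (hd2 i).eventually_pos_ray (hbi i).2 (by rw [ha2]; exact one_pos)] with t ht i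
    exact Or.inr (ht i).le
  rw [inner_sub_right, inner_neg_right] at h2
  exact inner_self_eq_zero (𝕜 := ℝ).1 (le_antisymm (by linarith) real_inner_self_nonneg)
end
end

section
/- Let m ≥ 1, let f, F_{1,i}, F_{2,i} be twice continuously differentiable, let x̄ ∈ M_s be biactive with SNO-LICQ, and let λ_{1,i}, λ_{2,i} satisfy ∇f(x̄) = Σ_{i=1}^m λ_{1,i}∇F_{1,i}(x̄) + λ_{2,i}∇F_{2,i}(x̄) with λ_{1,i} ≠ 0 and λ_{2,i} ≠ 0 for all i. Define the Lagrangian L = f − Σ_{i=1}^m (λ_{1,i}F_{1,i} + λ_{2,i}F_{2,i}) and the tangent space T_{x̄} = {ξ ∈ ℝⁿ : ⟨∇F_{1,i}(x̄), ξ⟩ = 0 and ⟨∇F_{2,i}(x̄), ξ⟩ = 0 for all i}, and assume the Hessian D²L(x̄) restricted to T_{x̄} is nonsingular, i.e., the only ξ ∈ T_{x̄} with ξᵀD²L(x̄)η = 0 for all η ∈ T_{x̄} is ξ = 0. Then x̄ is not a local minimizer of f on M_s (its biactive index is at least one, so its T-index does not vanish). -/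
open Filter Topology
open scoped RealInnerProductSpace

noncomputable section

/-- The Lagrange function L = f - Σᵢ (λ₁ᵢ F₁ᵢ + λ₂ᵢ F₂ᵢ). -/
def lagrangian {n m : ℕ} (f : EuclideanSpace ℝ (Fin n) → ℝ)
    (F1 F2 : Fin m → EuclideanSpace ℝ (Fin n) → ℝ) (l1 l2 : Fin m → ℝ) :
    EuclideanSpace ℝ (Fin n) → ℝ :=
  fun y => f y - ∑ i, (l1 i * F1 i y + l2 i * F2 i y)

/-- The tangent space T_x̄ = {ξ : ⟨∇F₁ᵢ(x̄), ξ⟩ = 0, ⟨∇F₂ᵢ(x̄), ξ⟩ = 0 ∀ i}. -/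
def tangentSpace {n m : ℕ} (F1 F2 : Fin m → EuclideanSpace ℝ (Fin n) → ℝ)
    (x : EuclideanSpace ℝ (Fin n)) : Set (EuclideanSpace ℝ (Fin n)) :=
  {ξ | ∀ i, ⟪gradient (F1 i) x, ξ⟫ = 0 ∧ ⟪gradient (F2 i) x, ξ⟫ = 0}

/-- The Hessian of L at x as a bilinear map: ξᵀ D²L(x) η. -/
def hessian {n : ℕ} (L : EuclideanSpace ℝ (Fin n) → ℝ) (x ξ η : EuclideanSpace ℝ (Fin n)) : ℝ :=
  fderiv ℝ (fderiv ℝ L) x ξ η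

/-- If `∇f(x)` is a combination of the linearly independent gradients `∇Fⱼ(x)` with a nonzero
coefficient at `j₀`, then `x` does not locally minimize `f` once the constraint `j₀` is dropped. -/
theorem not_isLocalMinOn_of_multiplier_ne_zero {E ι : Type*} [NormedAddCommGroup E]
    [InnerProductSpace ℝ E] [CompleteSpace E] [Fintype ι] {f : E → ℝ} {F : ι → E → ℝ} {x : E}
    (hf : ContDiff ℝ 1 f) (hF : ∀ j, ContDiff ℝ 1 (F j))
    (hv : LinearIndependent ℝ (fun j => gradient (F j) x)) {c : ι → ℝ}
    (hgrad : gradient f x = ∑ j, c j • gradient (F j) x) {j₀ : ι} (hc : c j₀ ≠ 0) :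
    ¬ IsLocalMinOn f {y | ∀ j, j ≠ j₀ → F j y = F j x} x := by
  classical
  intro hmin
  have hset : {y | ∀ j, j ≠ j₀ → F j y = F j x} =
      {y | ∀ j : {j // j ≠ j₀}, F j y = F j x} := by
    ext y
    simp
  rw [hset] at hmin
  obtain ⟨Λ, Λ₀, hne, hsum⟩ := IsLocalExtrOn.exists_multipliers_of_hasStrictFDerivAt
    (f := fun (j : {j // j ≠ j₀}) => F j) (Or.inl hmin)
    (fun j => (hF j).contDiffAt.hasStrictFDerivAt one_ne_zero)
    (hf.contDiffAt.hasStrictFDerivAt one_ne_zero)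
  have hsum' : ∑ j : {j // j ≠ j₀}, Λ j • gradient (F j) x + Λ₀ • gradient f x = 0 := by
    simpa [gradient] using congrArg (InnerProductSpace.toDual ℝ E).symm hsum
  let Λ' : ι → ℝ := fun j => if h : j ≠ j₀ then Λ ⟨j, h⟩ else 0
  have hext : ∑ j, Λ' j • gradient (F j) x = ∑ j : {j // j ≠ j₀}, Λ j • gradient (F j) x := by
    rw [← Fintype.sum_subtype_add_sum_subtype (fun j => j ≠ j₀)]
    have hz : ∑ j : {j // ¬ j ≠ j₀}, Λ' j • gradient (F j) x = 0 :=
      Finset.sum_eq_zero fun j _ => by simp [Λ', j.2]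
    rw [hz, add_zero]
    exact Finset.sum_congr rfl fun j _ => by simp [Λ', j.2]
  have hzero : ∑ j, (Λ' j + Λ₀ * c j) • gradient (F j) x = 0 := by
    simp only [add_smul, mul_smul, Finset.sum_add_distrib, ← Finset.smul_sum]
    rw [hext, ← hgrad, hsum']
  have hcoeff := Fintype.linearIndependent_iff.mp hv _ hzero
  have hΛ₀ : Λ₀ = 0 := by simpa [Λ', hc] using hcoeff j₀
  refine hne (Prod.ext (funext fun j => ?_) hΛ₀)
  simpa [Λ', hΛ₀, j.2] using hcoeff j

/-- For MPSC (m ≥ 1), a nondegenerate T-stationary point whose biactive multipliers all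
do not vanish is never a local minimizer: its biactive index is at least one, so its
T-index does not vanish. -/
theorem mpsc_nondegenerate_nonvanishing_not_local_min {n m : ℕ} (hm : 1 ≤ m)
    (f : EuclideanSpace ℝ (Fin n) → ℝ) (F1 F2 : Fin m → EuclideanSpace ℝ (Fin n) → ℝ)
    (hf : ContDiff ℝ 2 f) (hF1 : ∀ i, ContDiff ℝ 2 (F1 i)) (hF2 : ∀ i, ContDiff ℝ 2 (F2 i))
    (x : EuclideanSpace ℝ (Fin n))
    (hbi : ∀ i, F1 i x = 0 ∧ F2 i x = 0)
    (hLICQ : LinearIndependent ℝ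
      (Sum.elim (fun i => gradient (F1 i) x) (fun i => gradient (F2 i) x)))
    (l1 l2 : Fin m → ℝ)
    (hT : gradient f x = ∑ i, (l1 i • gradient (F1 i) x + l2 i • gradient (F2 i) x))
    (hND2 : ∀ i, l1 i ≠ 0 ∧ l2 i ≠ 0)
    (hND3 : ∀ ξ ∈ tangentSpace F1 F2 x,
      (∀ η ∈ tangentSpace F1 F2 x, hessian (lagrangian f F1 F2 l1 l2) x ξ η = 0) → ξ = 0) :
    ¬ IsLocalMinOn f {y | ∀ i, F1 i y * F2 i y = 0} x := by
  intro hmin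
  let i₀ : Fin m := ⟨0, hm⟩
  let F : Fin m ⊕ Fin m → EuclideanSpace ℝ (Fin n) → ℝ := Sum.elim F1 F2
  let c : Fin m ⊕ Fin m → ℝ := Sum.elim l1 l2
  have hv : LinearIndependent ℝ (fun j => gradient (F j) x) := by
    convert hLICQ using 1
    ext j : 1
    rcases j with i | i <;> rfl
  have hF : ∀ j, ContDiff ℝ 1 (F j) := by
    rintro (i | i)
    exacts [(hF1 i).of_le one_le_two, (hF2 i).of_le one_le_two]
  have hgrad : gradient f x = ∑ j, c j • gradient (F j) x := by
    simp [hT, Finset.sum_add_distrib, Fintype.sum_sum_type, c, F]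
  refine not_isLocalMinOn_of_multiplier_ne_zero (hf.of_le one_le_two) hF hv hgrad
    (j₀ := Sum.inl i₀) (hND2 i₀).1 (hmin.on_subset ?_)
  intro y hy i
  have h2 : F2 i y = 0 := (hy (Sum.inr i) Sum.inr_ne_inl).trans (hbi i).2
  rw [h2, mul_zero]
end
end

section
/- Consider the switching-constrained feasible set M_s = {x ∈ ℝⁿ : F_{1,i}(x)·F_{2,i}(x) = 0 for all i = 1,…,m} with f, F_{1,i}, F_{2,i} twice continuously differentiable, and let a < b be real numbers. Suppose the intermediate set M_a^b = {x ∈ M_s : a ≤ f(x) ≤ b} is compact, that at every x ∈ M_a^b the gradients {∇F_{1,i}(x) : F_{1,i}(x) = 0} ∪ {∇F_{2,i}(x) : F_{2,i}(x) = 0} are linearly independent (SNO-LICQ), and that no point x ∈ M_a^b is T-stationary, i.e., for no x ∈ M_a^b does ∇f(x) belong to the span of {∇F_{1,i}(x) : F_{1,i}(x) = 0} ∪ {∇F_{2,i}(x) : F_{2,i}(x) = 0}. Then the lower level sets M_a = {x ∈ M_s : f(x) ≤ a} and M_b = {x ∈ M_s : f(x) ≤ b} are homeomorphic. -/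
open Filter Topology
open scoped RealInnerProductSpace

noncomputable section

section Flow

variable {E : Type*} [NormedAddCommGroup E] [NormedSpace ℝ E]

theorem exists_global_integralCurve [CompleteSpace E] {v : E → E} {K L : NNReal}
    (hv : LipschitzWith K v) (hL : ∀ x, ‖v x‖ ≤ L) (x : E) :
    ∃ γ : ℝ → E, γ 0 = x ∧ ∀ t, HasDerivAt γ (v (γ t)) t := by
  have local_exists (R : ℝ) : ∃ α : ℝ → E, α 0 = x ∧
      (0 < R → ∀ t ∈ Set.Ioo (-R) R, HasDerivAt α (v (α t)) t) := by
    by_cases hR : 0 < R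
    · have h0 : (0 : ℝ) ∈ Set.Icc (-R) R := ⟨by linarith, hR.le⟩
      have hpl : IsPicardLindelof (fun _ : ℝ => v) (⟨0, h0⟩ : Set.Icc (-R) R) x
          (L * R.toNNReal) 0 L K :=
        { lipschitzOnWith := fun _ _ => hv.lipschitzOnWith
          continuousOn := fun _ _ => continuousOn_const
          norm_le := fun _ _ y _ => hL y
          mul_max_le := by simp [hR.le] }
      obtain ⟨α, hα, hd⟩ := hpl.exists_eq_forall_mem_Icc_hasDerivWithinAt₀
      exact ⟨α, hα, fun _ t ht =>
        (hd t (Set.Ioo_subset_Icc_self ht)).hasDerivAt (Icc_mem_nhds ht.1 ht.2)⟩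
    · exact ⟨fun _ => x, rfl, fun h => absurd h hR⟩
  choose α hα0 hα using local_exists
  have agree {R S : ℝ} (hR : 0 < R) (hRS : R ≤ S) : Set.EqOn (α R) (α S) (Set.Ioo (-R) R) := by
    refine ODE_solution_unique_of_mem_Ioo (v := fun _ => v) (s := fun _ => Set.univ) (K := K)
      (t₀ := 0) (fun _ _ => hv.lipschitzOnWith) ⟨by linarith, hR⟩
      (fun t ht => ⟨hα R hR t ht, trivial⟩)
      (fun t ht => ⟨hα S (hR.trans_le hRS) t ⟨by linarith [ht.1], by linarith [ht.2]⟩, trivial⟩) ?_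
    rw [hα0, hα0]
  refine ⟨fun t => α (|t| + 1) t, hα0 _, fun t => ?_⟩
  have hmem : t ∈ Set.Ioo (-(|t| + 1)) (|t| + 1) :=
    ⟨by linarith [neg_abs_le t], by linarith [le_abs_self t]⟩
  refine (hα _ (by positivity) t hmem).congr_of_eventuallyEq ?_
  filter_upwards [Ioo_mem_nhds hmem.1 hmem.2] with s hs
  have hs' : s ∈ Set.Ioo (-(|s| + 1)) (|s| + 1) :=
    ⟨by linarith [neg_abs_le s], by linarith [le_abs_self s]⟩
  rcases le_total (|s| + 1) (|t| + 1) with h | h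
  · exact agree (by positivity) h hs'
  · exact (agree (by positivity) h hs).symm

theorem integralCurve_dist_le {v : E → E} {K : NNReal} (hv : LipschitzWith K v)
    {γ δ : ℝ → E} (hγ : ∀ t, HasDerivAt γ (v (γ t)) t) (hδ : ∀ t, HasDerivAt δ (v (δ t)) t)
    {T : ℝ} (hT : 0 ≤ T) : dist (γ T) (δ T) ≤ dist (γ 0) (δ 0) * Real.exp (K * T) := by
  simpa using dist_le_of_trajectories_ODE (v := fun _ => v) (a := 0) (b := T) (fun _ => hv)
    (HasDerivAt.continuousOn fun t _ => hγ t) (fun t _ => (hγ t).hasDerivWithinAt)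
    (HasDerivAt.continuousOn fun t _ => hδ t) (fun t _ => (hδ t).hasDerivWithinAt) le_rfl T
    ⟨hT, le_rfl⟩

theorem exists_timeMap [CompleteSpace E] {v : E → E} {K L : NNReal}
    (hv : LipschitzWith K v) (hL : ∀ x, ‖v x‖ ≤ L) {T : ℝ} (hT : 0 ≤ T) :
    ∃ Φ : E ≃ₜ E, ∀ x, ∃ γ : ℝ → E,
      γ 0 = x ∧ γ T = Φ x ∧ ∀ t, HasDerivAt γ (v (γ t)) t := by
  choose γ hγ0 hγ using exists_global_integralCurve hv hL
  have unique {α β : ℝ → E} (hα : ∀ t, HasDerivAt α (v (α t)) t)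
      (hβ : ∀ t, HasDerivAt β (v (β t)) t) (h : α 0 = β 0) : α = β :=
    ODE_solution_unique_univ (v := fun _ => v) (s := fun _ => Set.univ) (K := K) (t₀ := 0)
      (fun _ => hv.lipschitzOnWith) (fun t => ⟨hα t, trivial⟩) (fun t => ⟨hβ t, trivial⟩) h
  have shift (x : E) (s t : ℝ) : γ (γ x s) t = γ x (t + s) := by
    refine congrFun (unique (hγ _) (β := fun t => γ x (t + s))
      (fun t => (hγ x (t + s)).comp_add_const t s) ?_) t
    simp [hγ0]
  have hneg (x : E) (t : ℝ) :
      HasDerivAt (fun t => γ x (-t)) ((fun y => -v y) (γ x (-t))) t := by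
    simpa [Function.comp_def] using (hγ x (-t)).scomp t (hasDerivAt_neg t)
  have hv' : LipschitzWith K (fun y => -v y) := hv.neg
  refine ⟨⟨⟨fun x => γ x T, fun x => γ x (-T), fun x => ?_, fun x => ?_⟩, ?_, ?_⟩,
    fun x => ⟨γ x, hγ0 x, rfl, hγ x⟩⟩
  · simp [shift, hγ0]
  · simp [shift, hγ0]
  · refine (LipschitzWith.of_dist_le_mul (K := ⟨Real.exp (K * T), (Real.exp_pos _).le⟩)
      fun x y => ?_).continuous
    have := integralCurve_dist_le hv (hγ x) (hγ y) hT
    rw [hγ0, hγ0, mul_comm] at this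
    exact this
  · refine (LipschitzWith.of_dist_le_mul (K := ⟨Real.exp (K * T), (Real.exp_pos _).le⟩)
      fun x y => ?_).continuous
    have := integralCurve_dist_le hv' (hneg x) (hneg y) hT
    simp only [neg_zero] at this
    rw [hγ0, hγ0, mul_comm] at this
    exact this

theorem zeroSet_invariant {v : E → E} {g : E → ℝ} (hg : Differentiable ℝ g)
    (h : ∀ x, g x = 0 → ∀ᶠ y in 𝓝 x, fderiv ℝ g y (v y) = 0) {γ : ℝ → E}
    (hγ : ∀ t, HasDerivAt γ (v (γ t)) t) {s : ℝ} (hs : g (γ s) = 0) (t : ℝ) : g (γ t) = 0 := by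
  have hcont : Continuous γ := continuous_iff_continuousAt.2 fun t => (hγ t).continuousAt
  have hderiv (t : ℝ) : HasDerivAt (fun t => g (γ t)) (fderiv ℝ g (γ t) (v (γ t))) t :=
    (hg (γ t)).hasFDerivAt.comp_hasDerivAt t (hγ t)
  have hclopen : IsClopen {t | g (γ t) = 0} := by
    refine ⟨isClosed_eq (hg.continuous.comp hcont) continuous_const, isOpen_iff_mem_nhds.2 ?_⟩
    intro t ht
    obtain ⟨ε, hε, hball⟩ := Metric.eventually_nhds_iff_ball.1 (hcont.tendsto t (h (γ t) ht))
    filter_upwards [Metric.ball_mem_nhds t hε] with u hu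
    have := (convex_ball t ε).is_const_of_fderivWithin_eq_zero (𝕜 := ℝ)
      (f := fun t => g (γ t)) (fun y _ => (hderiv y).differentiableAt.differentiableWithinAt)
      (fun y hy => ?_) hu (Metric.mem_ball_self hε)
    · exact this.trans ht
    · rw [fderivWithin_of_isOpen Metric.isOpen_ball hy]
      ext
      simp [(hderiv y).deriv, show fderiv ℝ g (γ y) (v (γ y)) = 0 from hball y hy]
  have := hclopen.eq_univ ⟨s, hs⟩
  exact this.ge (Set.mem_univ t)

theorem start_le_iff_end_le {h h' : ℝ → ℝ} (hh : ∀ t, HasDerivAt h (h' t) t) {a b : ℝ}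
    (hab : a ≤ b) (h0 : ∀ t, 0 ≤ h' t) (h1 : ∀ t, h' t ≤ 1)
    (heq : ∀ t, a ≤ h t → h t ≤ b → h' t = 1) : h 0 ≤ a ↔ h (b - a) ≤ b := by
  have hdiff : Differentiable ℝ h := fun t => (hh t).differentiableAt
  have hT : 0 ≤ b - a := sub_nonneg.2 hab
  constructor
  · intro hle
    have := image_sub_le_mul_sub_of_deriv_le hdiff (C := 1)
      (fun t => by rw [(hh t).deriv]; exact h1 t) hT
    linarith
  · intro hle
    by_contra! hlt
    have hmono : Monotone h := monotone_of_deriv_nonneg hdiff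
      fun t => by rw [(hh t).deriv]; exact h0 t
    have := (convex_Icc 0 (b - a)).mul_sub_le_image_sub_of_le_deriv (C := 1)
      hdiff.continuous.continuousOn hdiff.differentiableOn (fun t ht => ?_) 0 ⟨le_rfl, hT⟩ (b - a)
      ⟨hT, le_rfl⟩ hT
    · linarith
    · have ht := interior_subset ht
      rw [(hh t).deriv, heq t (hlt.le.trans (hmono ht.1)) ((hmono ht.2).trans hle)]

end Flow

section Field

variable {E : Type*} [NormedAddCommGroup E] [InnerProductSpace ℝ E]

theorem surjective_pi_inner_of_linearIndependent {κ : Type*} [Finite κ] {w : κ → E}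
    (hw : LinearIndependent ℝ w) :
    Function.Surjective (ContinuousLinearMap.pi fun k => innerSL ℝ (w k)) := by
  have := Fintype.ofFinite κ
  classical
  rw [← ContinuousLinearMap.coe_coe, ← LinearMap.range_eq_top]
  by_contra hne
  obtain ⟨Λ, hΛ0, hΛ⟩ := Submodule.exists_le_ker_of_lt_top _ (lt_top_iff_ne_top.2 hne)
  have hsum (z : κ → ℝ) : Λ z = ∑ k, z k * Λ (Pi.single k 1) := by
    refine (Λ.pi_apply_eq_sum_univ z).trans (Finset.sum_congr rfl fun k _ => ?_)
    congr 2
    ext j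
    simp [Pi.single_apply, eq_comm]
  have hzero : ∑ k, Λ (Pi.single k 1) • w k = 0 := by
    refine ext_inner_right ℝ fun x => ?_
    have := hΛ (LinearMap.mem_range_self _ x)
    rw [LinearMap.mem_ker, hsum] at this
    simpa [sum_inner, inner_smul_left, mul_comm] using this
  have hcoef := Fintype.linearIndependent_iff.1 hw _ hzero
  apply hΛ0
  ext k
  simpa using hcoef k

theorem exists_local_field [FiniteDimensional ℝ E] {κ : Type*} [Finite κ] {f : E → ℝ}
    {G : κ → E → ℝ} (hf : ContDiff ℝ 2 f) (hG : ∀ k, ContDiff ℝ 2 (G k)) {x : E}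
    (hindep : LinearIndependent ℝ fun k => gradient (G k) x)
    (hspan : gradient f x ∉ Submodule.span ℝ (Set.range fun k => gradient (G k) x)) :
    ∃ X : E → E, ∀ᶠ y in 𝓝 x, ContDiffAt ℝ 1 X y ∧ fderiv ℝ f y (X y) = 1 ∧
      ∀ k, fderiv ℝ (G k) y (X y) = 0 := by
  have := Fintype.ofFinite κ
  let H : Option κ → E → ℝ := fun o => o.elim f G
  have hH (o : Option κ) : ContDiff ℝ 2 (H o) := by cases o <;> simp [H, hf, hG]
  have hLI : LinearIndependent ℝ fun o => gradient (H o) x :=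
    linearIndependent_option.2 ⟨hindep, hspan⟩
  let D : E → E →L[ℝ] (Option κ → ℝ) := fun y => ContinuousLinearMap.pi fun o => fderiv ℝ (H o) y
  have hDsurj : Function.Surjective (D x) := by
    have hD : D x = ContinuousLinearMap.pi fun o => innerSL ℝ (gradient (H o) x) := by
      ext o
      simp [D, gradient]
    rw [hD]
    exact surjective_pi_inner_of_linearIndependent hLI
  have hDsmooth : ContDiff ℝ 1 D := by
    have (y : E) : D y = fderiv ℝ (fun z o => H o z) y :=
      (fderiv_pi fun o => ((hH o).differentiable (by norm_num)).differentiableAt).symm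
    rw [funext this]
    exact (contDiff_pi.2 hH).fderiv_right (m := 1) (by norm_num)
  obtain ⟨R, hR⟩ := (D x).exists_rightInverse_of_surjective (LinearMap.range_eq_top.2 hDsurj)
  let N : E → (Option κ → ℝ) →L[ℝ] (Option κ → ℝ) := fun y => (D y).comp R
  have hNsmooth : ContDiff ℝ 1 N := hDsmooth.clm_comp contDiff_const
  have hNx : IsUnit (N x) := by
    rw [show N x = 1 from hR]
    exact isUnit_one
  classical
  refine ⟨fun y => R (Ring.inverse (N y) (Pi.single none 1)), ?_⟩
  filter_upwards [hNsmooth.continuous.continuousAt (Units.isOpen.mem_nhds hNx)] with y hy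
  have key : D y (R (Ring.inverse (N y) (Pi.single none 1))) = Pi.single none 1 :=
    congrArg (fun A => A (Pi.single none (1 : ℝ))) (Ring.mul_inverse_cancel (N y) hy)
  refine ⟨?_, ?_, fun k => ?_⟩
  · obtain ⟨u, hu⟩ := hy
    have hinv : ContDiffAt ℝ 1 (fun y => Ring.inverse (N y)) y :=
      ContDiffAt.comp (g := Ring.inverse) y (hu ▸ contDiffAt_ringInverse ℝ u) hNsmooth.contDiffAt
    exact R.contDiff.contDiffAt.comp y (hinv.clm_apply contDiffAt_const)
  · simpa [D, H] using congrFun key none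
  · simpa [D, H] using congrFun key (some k)

open scoped Manifold ContDiff in
theorem exists_global_field [FiniteDimensional ℝ E] {ι : Type*} [Finite ι] {f : E → ℝ}
    {G : ι → E → ℝ} (hf : ContDiff ℝ 2 f) (hG : ∀ i, ContDiff ℝ 2 (G i)) {K : Set E}
    (hK : IsCompact K)
    (hindep : ∀ x ∈ K, LinearIndependent ℝ fun i : {i // G i x = 0} => gradient (G i) x)
    (hspan : ∀ x ∈ K, gradient f x ∉
      Submodule.span ℝ (Set.range fun i : {i // G i x = 0} => gradient (G i) x)) :
    ∃ v : E → E, ContDiff ℝ 1 v ∧ HasCompactSupport v ∧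
      (∀ y, 0 ≤ fderiv ℝ f y (v y)) ∧ (∀ y, fderiv ℝ f y (v y) ≤ 1) ∧
      (∀ y ∈ K, fderiv ℝ f y (v y) = 1) ∧
      ∀ i x, G i x = 0 → ∀ᶠ y in 𝓝 x, fderiv ℝ (G i) y (v y) = 0 := by
  have hloc (x : K) : ∃ X : E → E, ∃ U : Set E, IsOpen U ∧ (x : E) ∈ U ∧ Bornology.IsBounded U ∧
      ∀ y ∈ U, ContDiffAt ℝ 1 X y ∧ fderiv ℝ f y (X y) = 1 ∧
        ∀ i, G i y = 0 → ∀ z ∈ U, fderiv ℝ (G i) z (X z) = 0 := by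
    obtain ⟨X, hX⟩ := exists_local_field hf (fun i : {i // G i x = 0} => hG i)
      (hindep x x.2) (hspan x x.2)
    have hne : ∀ᶠ y in 𝓝 (x : E), ∀ i, G i x ≠ 0 → G i y ≠ 0 := by
      refine eventually_all.2 fun i => ?_
      by_cases hi : G i x = 0
      · simp [hi]
      · filter_upwards [(hG i).continuous.continuousAt.eventually_ne hi] with y hy _ using hy
    obtain ⟨U, hU, hUo, hxU⟩ := mem_nhds_iff.1
      ((hX.and hne).and (Metric.ball_mem_nhds (x : E) one_pos))
    refine ⟨X, U, hUo, hxU, Metric.isBounded_ball.subset fun y hy => (hU hy).2, fun y hy =>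
      ⟨(hU hy).1.1.1, (hU hy).1.1.2.1, fun i hi z hz => ?_⟩⟩
    have hix : G i x = 0 := by
      by_contra hix
      exact (hU hy).1.2 i hix hi
    exact (hU hz).1.1.2.2 ⟨i, hix⟩
  choose X U hUo hxU hUb hXU using hloc
  obtain ⟨s, hs⟩ := hK.elim_finite_subcover U hUo fun x hx => Set.mem_iUnion.2 ⟨⟨x, hx⟩, hxU _⟩
  obtain ⟨φ, hφ⟩ := SmoothPartitionOfUnity.exists_isSubordinate 𝓘(ℝ, E) hK.isClosed
    (fun k : s => U k) (fun k => hUo k) (by simpa [Set.iUnion_subtype] using hs)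
  have hφsmooth (k : s) : ContDiff ℝ 1 (φ k) :=
    ((φ k).contMDiff.contDiff).of_le (by exact_mod_cast le_top)
  have hfderiv (g : E → ℝ) (y : E) : fderiv ℝ g y (∑ k, φ k y • X k y) =
      ∑ k, φ k y * fderiv ℝ g y (X k y) := by simp
  have hfv (y : E) : fderiv ℝ f y (∑ k, φ k y • X k y) = ∑ᶠ k, φ k y := by
    rw [hfderiv, finsum_eq_sum_of_fintype]
    refine Finset.sum_congr rfl fun k _ => ?_
    by_cases hy : y ∈ tsupport (φ k)
    · rw [(hXU k y (hφ k hy)).2.1, mul_one]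
    · rw [image_eq_zero_of_notMem_tsupport hy, zero_mul]
  refine ⟨fun y => ∑ k, φ k y • X k y, ContDiff.sum fun k _ => ?_, ?_, fun y => ?_, fun y => ?_,
    fun y hy => ?_, fun i x hix => ?_⟩
  · refine contDiff_iff_contDiffAt.2 fun y => ?_
    by_cases hy : y ∈ tsupport (φ k)
    · exact (hφsmooth k).contDiffAt.smul (hXU k y (hφ k hy)).1
    · refine contDiffAt_const (c := (0 : E)) |>.congr_of_eventuallyEq ?_
      filter_upwards [notMem_tsupport_iff_eventuallyEq.1 hy] with z hz
      simp [hz]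
  · refine HasCompactSupport.of_support_subset_isCompact
      (K := ⋃ k : s, tsupport (φ k)) (isCompact_iUnion fun k => ?_) fun y hy => ?_
    · exact Metric.isCompact_of_isClosed_isBounded (isClosed_tsupport _) ((hUb k).subset (hφ k))
    · by_contra hn
      simp only [Set.mem_iUnion, not_exists] at hn
      exact hy (Finset.sum_eq_zero fun k _ => by
        rw [image_eq_zero_of_notMem_tsupport (hn k), zero_smul])
  · rw [hfv]
    exact finsum_nonneg fun k => φ.nonneg k y
  · rw [hfv]
    exact φ.sum_le_one y
  · rw [hfv]
    exact φ.sum_eq_one hy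
  · have : ∀ k : s, ∀ᶠ y in 𝓝 x, φ k y * fderiv ℝ (G i) y (X k y) = 0 := fun k => by
      by_cases hx : x ∈ tsupport (φ k)
      · filter_upwards [(hUo k).mem_nhds (hφ k hx)] with y hy
        rw [(hXU k x (hφ k hx)).2.2 i hix y hy, mul_zero]
      · filter_upwards [notMem_tsupport_iff_eventuallyEq.1 hx] with y hy
        simp [hy]
    filter_upwards [eventually_all.2 this] with y hy
    rw [hfderiv]
    exact Finset.sum_eq_zero fun k _ => hy k

end Field

/-- Deformation theorem for MPSC: if the compact intermediate set M_a^b satisfies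
SNO-LICQ everywhere and contains no T-stationary point, then the lower level sets
M_a and M_b are homeomorphic. -/
theorem mpsc_deformation {n m : ℕ}
    (f : EuclideanSpace ℝ (Fin n) → ℝ) (F1 F2 : Fin m → EuclideanSpace ℝ (Fin n) → ℝ)
    (hf : ContDiff ℝ 2 f) (hF1 : ∀ i, ContDiff ℝ 2 (F1 i)) (hF2 : ∀ i, ContDiff ℝ 2 (F2 i))
    (a b : ℝ) (hab : a < b)
    (hcompact : IsCompact
      {x : EuclideanSpace ℝ (Fin n) | (∀ i, F1 i x * F2 i x = 0) ∧ a ≤ f x ∧ f x ≤ b})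
    (hLICQ : ∀ x : EuclideanSpace ℝ (Fin n),
      (∀ i, F1 i x * F2 i x = 0) → a ≤ f x → f x ≤ b →
      LinearIndependent ℝ (Sum.elim
        (fun i : {i : Fin m // F1 i x = 0} => gradient (F1 i.1) x)
        (fun i : {i : Fin m // F2 i x = 0} => gradient (F2 i.1) x)))
    (hnostat : ∀ x : EuclideanSpace ℝ (Fin n),
      (∀ i, F1 i x * F2 i x = 0) → a ≤ f x → f x ≤ b →
      gradient f x ∉ Submodule.span ℝ
        ({v | ∃ i, F1 i x = 0 ∧ v = gradient (F1 i) x} ∪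
         {v | ∃ i, F2 i x = 0 ∧ v = gradient (F2 i) x})) :
    Nonempty
      (({x : EuclideanSpace ℝ (Fin n) | (∀ i, F1 i x * F2 i x = 0) ∧ f x ≤ a} : Set _) ≃ₜ
       ({x : EuclideanSpace ℝ (Fin n) | (∀ i, F1 i x * F2 i x = 0) ∧ f x ≤ b} : Set _)) := by
  let G : Fin m ⊕ Fin m → EuclideanSpace ℝ (Fin n) → ℝ := Sum.elim F1 F2
  have hG (j) : ContDiff ℝ 2 (G j) := by cases j <;> simp [G, hF1, hF2]
  have hLI : ∀ x ∈ {x : EuclideanSpace ℝ (Fin n) |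
      (∀ i, F1 i x * F2 i x = 0) ∧ a ≤ f x ∧ f x ≤ b},
      LinearIndependent ℝ fun j : {j // G j x = 0} => gradient (G j) x := by
    intro x hx
    let e : {j // G j x = 0} → {i : Fin m // F1 i x = 0} ⊕ {i : Fin m // F2 i x = 0} := fun j =>
      match j with
      | ⟨.inl i, hi⟩ => .inl ⟨i, hi⟩
      | ⟨.inr i, hi⟩ => .inr ⟨i, hi⟩
    have he : Function.Injective e := by
      rintro ⟨i | i, hi⟩ ⟨j | j, hj⟩ h <;>
        simpa [e] using congrArg (Sum.map Subtype.val Subtype.val) h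
    convert (hLICQ x hx.1 hx.2.1 hx.2.2).comp e he using 1
    ext1 ⟨i | i, hi⟩ <;> rfl
  have hns : ∀ x ∈ {x : EuclideanSpace ℝ (Fin n) |
      (∀ i, F1 i x * F2 i x = 0) ∧ a ≤ f x ∧ f x ≤ b},
      gradient f x ∉ Submodule.span ℝ
        (Set.range fun j : {j // G j x = 0} => gradient (G j) x) := by
    refine fun x hx h => hnostat x hx.1 hx.2.1 hx.2.2 (Submodule.span_mono ?_ h)
    rintro _ ⟨⟨i | i, hi⟩, rfl⟩
    · exact .inl ⟨i, hi, rfl⟩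
    · exact .inr ⟨i, hi, rfl⟩
  obtain ⟨v, hv, hvc, hv0, hv1, hvK, hvG⟩ := exists_global_field hf hG hcompact hLI hns
  obtain ⟨K, hK⟩ := hv.lipschitzWith_of_hasCompactSupport hvc one_ne_zero
  obtain ⟨L, hL⟩ := hv.continuous.bounded_above_of_compact_support hvc
  obtain ⟨Φ, hΦ⟩ := exists_timeMap hK (L := L.toNNReal)
    (fun x => (hL x).trans (Real.le_coe_toNNReal L)) (sub_nonneg.2 hab.le)
  refine ⟨Φ.subtype fun x => ?_⟩
  obtain ⟨γ, hγ0, hγT, hγ⟩ := hΦ x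
  have hinv (j s t) (h : G j (γ s) = 0) : G j (γ t) = 0 :=
    zeroSet_invariant ((hG j).differentiable two_ne_zero) (hvG j) hγ h t
  have hfeas (s t) (h : ∀ i, F1 i (γ s) * F2 i (γ s) = 0) (i) : F1 i (γ t) * F2 i (γ t) = 0 :=
    mul_eq_zero.2 ((mul_eq_zero.1 (h i)).imp (hinv (.inl i) s t) (hinv (.inr i) s t))
  have hlevel (h : ∀ i, F1 i (γ 0) * F2 i (γ 0) = 0) : f (γ 0) ≤ a ↔ f (γ (b - a)) ≤ b :=
    start_le_iff_end_le
      (fun t => (hf.differentiable two_ne_zero (γ t)).hasFDerivAt.comp_hasDerivAt t (hγ t)) hab.le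
      (fun t => hv0 _) (fun t => hv1 _) fun t hat hbt => hvK _ ⟨hfeas 0 t h, hat, hbt⟩
  simp only [Set.mem_ofPred_eq]
  rw [← hγT, ← hγ0]
  exact ⟨fun h => ⟨hfeas _ _ h.1, (hlevel h.1).1 h.2⟩,
    fun h => ⟨hfeas _ _ h.1, (hlevel (hfeas _ _ h.1)).2 h.2⟩⟩
end
end
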